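/- Let N be an integer with N ≥ 2, let μ₁ ≥ μ₂ ≥ ... ≥ μ_N > 0 be reals, let a be an integer with 1 ≤ a < N, and let K be an integer with a ≤ K ≤ N. Set H_K = ∑_{k=1}^K 1/μ_k and define the probability vector d^K by d^K_k = (1/μ_k)/H_K for k ≤ K and d^K_k = 0 for k > K. For a probability vector d = (d₁,...,d_N) define F_a(d) = ∑_{k=1}^N μ_k d_k − max_{J ⊆ {1,...,N}, |J| = a} ∑_{j∈J} μ_j d_j. Then F_a(d^K) = (K − a)/H_K; consequently the supremum of F_a over all probability vectors is at least (K − a)/H_K for every such K. -/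

import Mathlib

open Finset

/-- The reward fraction captured by the defender's best fixed set of `a` scanned
locations, against attack frequency vector `d` and location rewards `μ`. -/
noncomputable def defenderBest (N a : ℕ) (μ d : Fin N → ℝ) : ℝ :=
  sSup {x : ℝ | ∃ J : Finset (Fin N), J.card = a ∧ x = ∑ j ∈ J, μ j * d j}

/-- The attacker's worst-case average reward margin `F_a(d)`. -/
noncomputable def attackerMargin (N a : ℕ) (μ d : Fin N → ℝ) : ℝ :=
  (∑ k, μ k * d k) - defenderBest N a μ d

/-- `d` is a probability vector over the `N` locations. -/
def IsProbVec (N : ℕ) (d : Fin N → ℝ) : Prop :=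
  (∀ k, 0 ≤ d k) ∧ ∑ k, d k = 1

theorem defenderBest_nonneg {N : ℕ} (a : ℕ) {μ d : Fin N → ℝ} (hμ : ∀ k, 0 ≤ μ k)
    (hd : ∀ k, 0 ≤ d k) : 0 ≤ defenderBest N a μ d := by
  apply Real.sSup_nonneg
  rintro x ⟨J, -, rfl⟩
  exact Finset.sum_nonneg fun j _ => mul_nonneg (hμ j) (hd j)

theorem attackerMargin_le_sum {N : ℕ} (a : ℕ) {μ d : Fin N → ℝ} (hμ : ∀ k, 0 ≤ μ k)
    (hd : IsProbVec N d) : attackerMargin N a μ d ≤ ∑ k, μ k := by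
  have hsum : ∑ k, μ k * d k ≤ ∑ k, μ k := Finset.sum_le_sum fun k _ =>
    mul_le_of_le_one_right (hμ k) <|
      (Finset.single_le_sum (fun j _ => hd.1 j) (Finset.mem_univ k)).trans_eq hd.2
  have := defenderBest_nonneg a hμ hd.1
  unfold attackerMargin
  linarith

theorem card_filter_fin_val_lt {N m : ℕ} (h : m ≤ N) :
    (Finset.univ.filter fun k : Fin N => (k : ℕ) < m).card = m := by
  simp [Fin.card_filter_val_lt, h]

/-- If the product `μ k * d k` equals a constant `c` on the first `K` locations and vanishes
elsewhere, the best set of `a ≤ K` locations captures `a * c`. -/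
theorem defenderBest_of_equalizing {N a K : ℕ} (haK : a ≤ K) (hKN : K ≤ N) {μ d : Fin N → ℝ}
    {c : ℝ} (hc : 0 ≤ c) (h : ∀ k : Fin N, μ k * d k = if (k : ℕ) < K then c else 0) :
    defenderBest N a μ d = a * c := by
  refine IsGreatest.csSup_eq
    ⟨⟨_, card_filter_fin_val_lt (haK.trans hKN), ?_⟩, ?_⟩
  · rw [Finset.sum_congr rfl (g := fun _ => c), Finset.sum_const,
      card_filter_fin_val_lt (haK.trans hKN), nsmul_eq_mul]
    intro k hk
    rw [h, if_pos ((Finset.mem_filter.1 hk).2.trans_le haK)]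
  · rintro x ⟨J, rfl, rfl⟩
    rw [← nsmul_eq_mul]
    refine Finset.sum_le_card_nsmul _ _ _ fun j _ => ?_
    rw [h]
    split_ifs
    exacts [le_rfl, hc]

/-- The equalizing distribution `d^K` achieves `F_a(d^K) = (K − a)/H_K`, where
`H_K = ∑_{k=1}^K 1/μ_k`; consequently the supremum of `F_a` over probability vectors
is at least `(K − a)/H_K`. -/
theorem equalizing_distribution_value
    (N a K : ℕ) (hN : 2 ≤ N) (ha1 : 1 ≤ a) (haN : a < N)
    (haK : a ≤ K) (hKN : K ≤ N)
    (μ : Fin N → ℝ) (hμpos : ∀ k, 0 < μ k)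
    (hμmono : ∀ k j : Fin N, k ≤ j → μ j ≤ μ k)
    (H : ℝ) (hH : H = ∑ k ∈ Finset.univ.filter (fun k : Fin N => (k : ℕ) < K), 1 / μ k)
    (dK : Fin N → ℝ)
    (hdK : ∀ k : Fin N, dK k = if (k : ℕ) < K then (1 / μ k) / H else 0) :
    attackerMargin N a μ dK = ((K : ℝ) - a) / H ∧
      ((K : ℝ) - a) / H ≤
        sSup {x : ℝ | ∃ d : Fin N → ℝ, IsProbVec N d ∧ x = attackerMargin N a μ d} := by
  have hHpos : 0 < H := by
    rw [hH]
    exact Finset.sum_pos (fun k _ => one_div_pos.2 (hμpos k))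
      ⟨⟨0, by omega⟩, by simpa using (by omega : 0 < K)⟩
  have hprod : ∀ k : Fin N, μ k * dK k = if (k : ℕ) < K then 1 / H else 0 := by
    intro k
    have := (hμpos k).ne'
    rw [hdK]
    split_ifs
    · field_simp
    · simp
  have hmargin : attackerMargin N a μ dK = ((K : ℝ) - a) / H := by
    rw [attackerMargin, defenderBest_of_equalizing haK hKN (one_div_pos.2 hHpos).le hprod,
      Finset.sum_congr rfl fun k _ => hprod k, ← Finset.sum_filter, Finset.sum_const,
      card_filter_fin_val_lt hKN, nsmul_eq_mul]
    ring
  have hprob : IsProbVec N dK := by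
    constructor
    · intro k
      have := hμpos k
      rw [hdK]
      split_ifs <;> positivity
    · rw [Finset.sum_congr rfl fun k _ => hdK k, ← Finset.sum_filter, ← Finset.sum_div, ← hH,
        div_self hHpos.ne']
  refine ⟨hmargin, le_csSup ⟨∑ k, μ k, ?_⟩ ⟨dK, hprob, hmargin.symm⟩⟩
  rintro x ⟨d, hd, rfl⟩
  exact attackerMargin_le_sum a (fun k => (hμpos k).le) hd
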